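/- arXiv:2504.18292 — 2 statements merged into one kernel-verified Lean document; each statement's English description precedes it below -/
import Mathlib

section
/- Let u, v, L ∈ ℂ and let Ψ(w) = Γ(u+w)Γ(u−w)Γ(v+w)Γ(v−w)e^{Lw²}/(Γ(2w)Γ(−2w)). Then for every w ∈ ℂ such that 2w ∉ ℤ and none of u+w, u−w, v+w, v−w, u+w−1, u−w+1, v+w−1, v−w+1 is a nonpositive integer, one has (w−1)(u−w)(v−w)·Ψ(w) = w(u+w−1)(v+w−1)·Ψ(1−w)·e^{L(2w−1)}. -/
open Complex

/-- The weight function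
`Ψ(w) = Γ(u+w)Γ(u−w)Γ(v+w)Γ(v−w)e^{Lw²}/(Γ(2w)Γ(−2w))`. -/
noncomputable def Psi (u v L w : ℂ) : ℂ :=
  Complex.Gamma (u + w) * Complex.Gamma (u - w) * Complex.Gamma (v + w) *
    Complex.Gamma (v - w) * Complex.exp (L * w ^ 2) /
    (Complex.Gamma (2 * w) * Complex.Gamma (-(2 * w)))

/-- The functional Bethe equation satisfied by the weight function `Ψ`:
`(w−1)(u−w)(v−w)·Ψ(w) = w(u+w−1)(v+w−1)·Ψ(1−w)·e^{L(2w−1)}`. -/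
theorem Psi_functional_bethe_equation (u v L w : ℂ)
    (hw : ∀ n : ℤ, 2 * w ≠ (n : ℂ))
    (h1 : ∀ n : ℕ, u + w ≠ -(n : ℂ)) (h2 : ∀ n : ℕ, u - w ≠ -(n : ℂ))
    (h3 : ∀ n : ℕ, v + w ≠ -(n : ℂ)) (h4 : ∀ n : ℕ, v - w ≠ -(n : ℂ))
    (h5 : ∀ n : ℕ, u + w - 1 ≠ -(n : ℂ)) (h6 : ∀ n : ℕ, u - w + 1 ≠ -(n : ℂ))
    (h7 : ∀ n : ℕ, v + w - 1 ≠ -(n : ℂ)) (h8 : ∀ n : ℕ, v - w + 1 ≠ -(n : ℂ)) :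
    (w - 1) * (u - w) * (v - w) * Psi u v L w
      = w * (u + w - 1) * (v + w - 1) * Psi u v L (1 - w) * Complex.exp (L * (2 * w - 1)) := by
  have hw0 : w ≠ 0 := fun h => hw 0 (by simp [h])
  have hw1 : w - 1 ≠ 0 := fun h => hw 2 (by push_cast; linear_combination 2 * h)
  have hw2 : 2 * w - 1 ≠ 0 := fun h => hw 1 (by push_cast; linear_combination h)
  have gamma_succ {x y : ℂ} (hx : x ≠ 0) (hy : y = x + 1) : Gamma y = x * Gamma x := by
    rw [hy, Gamma_add_one x hx]
  have hu1 : Gamma (u + w) = (u + w - 1) * Gamma (u + w - 1) :=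
    gamma_succ (by simpa using h5 0) (by ring)
  have hu2 : Gamma (u - w + 1) = (u - w) * Gamma (u - w) :=
    gamma_succ (by simpa using h2 0) rfl
  have hv1 : Gamma (v + w) = (v + w - 1) * Gamma (v + w - 1) :=
    gamma_succ (by simpa using h7 0) (by ring)
  have hv2 : Gamma (v - w + 1) = (v - w) * Gamma (v - w) :=
    gamma_succ (by simpa using h4 0) rfl
  have hd1 : Gamma (2 * w) = (2 * w - 1) * (2 * (w - 1) * Gamma (2 * w - 2)) := by
    rw [gamma_succ hw2 (by ring),
      gamma_succ (x := 2 * (w - 1)) (mul_ne_zero two_ne_zero hw1) (by ring),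
      show 2 * (w - 1) = 2 * w - 2 by ring]
  have hd2 : Gamma (2 - 2 * w) = (2 * w - 1) * (2 * w * Gamma (-(2 * w))) := by
    rw [gamma_succ (neg_ne_zero.mpr hw2) (by ring),
      gamma_succ (x := -(2 * w)) (neg_ne_zero.mpr (mul_ne_zero two_ne_zero hw0)) (by ring)]
    ring
  have hexp : exp (L * w ^ 2) = exp (L * (1 - w) ^ 2) * exp (L * (2 * w - 1)) := by
    rw [← exp_add]
    ring_nf
  have hg1 : Gamma (2 * w - 2) ≠ 0 :=
    Gamma_ne_zero fun n hn => hw (2 - n) (by push_cast; linear_combination hn)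
  have hg2 : Gamma (-(2 * w)) ≠ 0 :=
    Gamma_ne_zero fun n hn => hw n (by push_cast; linear_combination -hn)
  have hquot : (w - 1) / (Gamma (2 * w) * Gamma (-(2 * w))) =
      w / (Gamma (2 - 2 * w) * Gamma (2 * w - 2)) := by
    rw [hd1, hd2]
    generalize Gamma (2 * w - 2) = a at hg1 ⊢
    generalize Gamma (-(2 * w)) = b at hg2 ⊢
    rw [div_eq_div_iff (by simp [*]) (by simp [*])]
    ring
  unfold Psi
  rw [show u + (1 - w) = u - w + 1 by ring, show u - (1 - w) = u + w - 1 by ring,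
    show v + (1 - w) = v - w + 1 by ring, show v - (1 - w) = v + w - 1 by ring,
    show -(2 * (1 - w)) = 2 * w - 2 by ring, show 2 * (1 - w) = 2 - 2 * w by ring,
    hu1, hu2, hv1, hv2, hexp]
  linear_combination ((u - w) * (v - w) * (u + w - 1) * (v + w - 1) * Gamma (u + w - 1) *
    Gamma (u - w) * Gamma (v + w - 1) * Gamma (v - w) *
    (exp (L * (1 - w) ^ 2) * exp (L * (2 * w - 1)))) * hquot
end

section
/- Let ũ, ṽ > 0 and let w̃ ∈ ℂ with w̃ ≠ 0, w̃² ≠ ũ², and w̃² ≠ ṽ². Then, with Ψ_{u,v,L}(w) = Γ(u+w)Γ(u−w)Γ(v+w)Γ(v−w)e^{Lw²}/(Γ(2w)Γ(−2w)), one has lim_{L→∞} (1/L)·Ψ_{ũ/√L, ṽ/√L, L}(w̃/√L) = −4w̃² e^{w̃²} / ((ũ² − w̃²)(ṽ² − w̃²)), the limit being taken along real L → +∞. -/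
open Complex Filter

/-- Near its pole at `0`, the Gamma function satisfies `Γ(c/√L)/√L → 1/c` as `L → ∞`. -/
theorem tendsto_Gamma_div_sqrt (c : ℂ) (hc : c ≠ 0) :
    Tendsto (fun L : ℝ => Complex.Gamma (c / (Real.sqrt L : ℂ)) / (Real.sqrt L : ℂ))
      atTop (nhds c⁻¹) := by
  have hpos : ∀ᶠ L : ℝ in atTop, (Real.sqrt L : ℂ) ≠ 0 := by
    filter_upwards [eventually_gt_atTop 0] with L hL
    exact_mod_cast (Real.sqrt_pos.2 hL).ne'
  have hz : Tendsto (fun L : ℝ => c / (Real.sqrt L : ℂ)) atTop (nhdsWithin 0 {0}ᶜ) := by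
    refine tendsto_nhdsWithin_iff.2 ⟨?_, ?_⟩
    · have h : Tendsto (fun L : ℝ => (((Real.sqrt L)⁻¹ : ℝ) : ℂ)) atTop (nhds ((0 : ℝ) : ℂ)) :=
        (continuous_ofReal.tendsto 0).comp
          (tendsto_inv_atTop_zero.comp Real.tendsto_sqrt_atTop)
      simpa [div_eq_mul_inv] using h.const_mul c
    · filter_upwards [hpos] with L hL
      exact div_ne_zero hc hL
  have h := (tendsto_self_mul_Gamma_nhds_zero.comp hz).const_mul c⁻¹
  rw [mul_one] at h
  refine h.congr' ?_
  filter_upwards [hpos] with L hL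
  simp only [Function.comp_apply]
  field_simp

/-- Scaling limit as `L → ∞` of the open KPZ weight function with boundary parameters
`u = ũ/√L`, `v = ṽ/√L` at `w = w̃/√L`:
`(1/L)·Ψ_{ũ/√L, ṽ/√L, L}(w̃/√L) → −4w̃²e^{w̃²}/((ũ²−w̃²)(ṽ²−w̃²))`. -/
theorem Psi_scaling_limit (ut vt : ℝ) (hu : 0 < ut) (hv : 0 < vt)
    (wt : ℂ) (hw : wt ≠ 0) (hwu : wt ^ 2 ≠ (ut : ℂ) ^ 2) (hwv : wt ^ 2 ≠ (vt : ℂ) ^ 2) :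
    Tendsto
      (fun L : ℝ =>
        (1 / (L : ℂ)) *
          Psi ((ut : ℂ) / (Real.sqrt L : ℂ)) ((vt : ℂ) / (Real.sqrt L : ℂ)) (L : ℂ)
            (wt / (Real.sqrt L : ℂ)))
      atTop
      (nhds (-4 * wt ^ 2 * Complex.exp (wt ^ 2) /
        (((ut : ℂ) ^ 2 - wt ^ 2) * ((vt : ℂ) ^ 2 - wt ^ 2)))) := by
  have key (c d : ℂ) (h : d ^ 2 ≠ c ^ 2) : c + d ≠ 0 ∧ c - d ≠ 0 :=
    ⟨fun h' => h (by linear_combination (d - c) * h'),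
      fun h' => h (by linear_combination (-d - c) * h')⟩
  obtain ⟨hu1, hu2⟩ := key _ _ hwu
  obtain ⟨hv1, hv2⟩ := key _ _ hwv
  have h2 : 2 * wt ≠ 0 := mul_ne_zero two_ne_zero hw
  have hn2 : -(2 * wt) ≠ 0 := neg_ne_zero.2 h2
  have hlim := (((((tendsto_Gamma_div_sqrt _ hu1).mul (tendsto_Gamma_div_sqrt _ hu2)).mul
    (tendsto_Gamma_div_sqrt _ hv1)).mul (tendsto_Gamma_div_sqrt _ hv2)).mul_const
    (Complex.exp (wt ^ 2))).div
    ((tendsto_Gamma_div_sqrt _ h2).mul (tendsto_Gamma_div_sqrt _ hn2))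
    (mul_ne_zero (inv_ne_zero h2) (inv_ne_zero hn2))
  have hval : -4 * wt ^ 2 * Complex.exp (wt ^ 2) /
      (((ut : ℂ) ^ 2 - wt ^ 2) * ((vt : ℂ) ^ 2 - wt ^ 2)) =
      ((ut : ℂ) + wt)⁻¹ * ((ut : ℂ) - wt)⁻¹ * ((vt : ℂ) + wt)⁻¹ * ((vt : ℂ) - wt)⁻¹ *
        Complex.exp (wt ^ 2) / ((2 * wt)⁻¹ * (-(2 * wt))⁻¹) := by
    rw [sq_sub_sq, sq_sub_sq]
    field_simp
    ring
  rw [hval]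
  refine hlim.congr' ?_
  filter_upwards [eventually_gt_atTop 0] with L hL
  have hs : (Real.sqrt L : ℂ) ≠ 0 := by exact_mod_cast (Real.sqrt_pos.2 hL).ne'
  have hsq : (L : ℂ) = (Real.sqrt L : ℂ) ^ 2 := by
    exact_mod_cast (Real.sq_sqrt hL.le).symm
  have hexp : (L : ℂ) * (wt / (Real.sqrt L : ℂ)) ^ 2 = wt ^ 2 := by
    rw [div_pow, ← hsq]
    exact mul_div_cancel₀ _ (by exact_mod_cast hL.ne')
  unfold Psi
  rw [hexp, ← add_div, ← sub_div, ← add_div, ← sub_div, ← mul_div_assoc 2 wt, ← neg_div, Pi.div_apply]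
  generalize Complex.Gamma (2 * wt / (Real.sqrt L : ℂ)) = A
  generalize Complex.Gamma (-(2 * wt) / (Real.sqrt L : ℂ)) = B
  rw [hsq]
  simp only [div_eq_mul_inv, mul_inv, inv_inv]
  field_simp
end
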